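/- The sum Σ_{i ≥ 2} 1/x_i over the first coordinates x_1 < x_2 < ⋯ of all N-solutions tends to zero as N → ∞; that is, for every ε > 0 there exists N_0 such that for every integer N ≥ N_0 admitting at least one N-solution, the sum of 1/x over all N-solutions (x, m) with x > x_1 is less than ε. -/

import Mathlib

/-- For an integer `N ≥ 2`, a pair `(x, m)` with `x ≥ 2`, `m ≥ 2` is an `N`-solution if
`(x^m - 1)/(x - 1) = 1 + x + ⋯ + x^(m-1) = N`. -/
def IsNSol (N x m : ℕ) : Prop :=
  2 ≤ x ∧ 2 ≤ m ∧ ∑ i ∈ Finset.range m, x ^ i = N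

/-- Multilinear expansion of a determinant whose columns are combinations of weighted vectors. -/
lemma pow_dvd_det_of_weighted_sum {n κ : Type*} [Fintype n] [DecidableEq n] [Fintype κ]
    (q : ℤ) (wt : κ → ℕ) (Z : n → κ → ℤ) (c : κ → n → ℤ) (W : ℕ)
    (hW : ∀ σ : n → κ, Function.Injective σ → W ≤ ∑ μ, wt (σ μ)) :
    q ^ W ∣ (Matrix.of fun a μ => ∑ l, q ^ wt l * c l μ * Z a l).det := by
  rw [← Matrix.det_transpose]
  have h1 : (Matrix.of fun a μ => ∑ l, q ^ wt l * c l μ * Z a l).transpose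
      = fun μ => ∑ l, (q ^ wt l * c l μ) • (fun a => Z a l) := by
    ext μ a
    simp [Matrix.transpose_apply, Finset.sum_apply]
  rw [h1]
  change q ^ W ∣ Matrix.detRowAlternating (fun μ => ∑ l, (q ^ wt l * c l μ) • (fun a => Z a l))
  rw [← AlternatingMap.coe_multilinearMap, MultilinearMap.map_sum]
  refine Finset.dvd_sum fun σ _ => ?_
  rw [MultilinearMap.map_smul_univ]
  by_cases hσ : Function.Injective σ
  · refine Dvd.dvd.trans (pow_dvd_pow q (hW σ hσ)) ?_
    rw [Finset.prod_mul_distrib, Finset.prod_pow_eq_pow_sum, smul_eq_mul, mul_assoc]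
    exact Dvd.intro _ rfl
  · have : (Matrix.detRowAlternating : (n → ℤ) [⋀^n]→ₗ[ℤ] ℤ) (fun μ a => Z a (σ μ)) = 0 := by
      apply AlternatingMap.map_eq_zero_of_not_injective
      intro hinj
      exact hσ fun i j hij => hinj (by simp [hij])
    rw [AlternatingMap.coe_multilinearMap, this]
    simp

lemma sum_range_le_sum_of_card_le {n : Type*} [Fintype n] (f : n → ℕ)
    (hf : ∀ k < Fintype.card n, (Finset.univ.filter fun a => f a ≤ k).card ≤ k + 1) :
    ∑ i ∈ Finset.range (Fintype.card n), i ≤ ∑ a, f a := by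
  set D := Fintype.card n with hD
  have h1 : ∀ a, ((Finset.range D).filter fun k => k < f a).card ≤ f a := fun a => by
    calc _ ≤ (Finset.range (f a)).card := Finset.card_le_card fun k hk => by
          simp at hk ⊢; exact hk.2
      _ = f a := by simp
  calc ∑ i ∈ Finset.range D, i = ∑ k ∈ Finset.range D, (D - 1 - k) :=
        (Finset.sum_range_reflect (fun i => i) D).symm
    _ ≤ ∑ k ∈ Finset.range D, (Finset.univ.filter fun a => k < f a).card := by
        refine Finset.sum_le_sum fun k hk => ?_
        have h2 := hf k (Finset.mem_range.mp hk)
        have h3 := Finset.card_filter_add_card_filter_not (s := (Finset.univ : Finset n))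
          (fun a => f a ≤ k)
        simp only [not_le, Finset.card_univ] at h3
        omega
    _ = ∑ a, ((Finset.range D).filter fun k => k < f a).card := by
        simp only [Finset.card_filter]
        exact Finset.sum_comm
    _ ≤ _ := Finset.sum_le_sum fun a _ => h1 a

lemma sum_range_le_sum_weight {n : Type*} [Fintype n] (M m : ℕ) (hm : Fintype.card n ≤ m)
    (σ : n → Fin M ⊕ n) (hσ : Function.Injective σ) :
    ∑ i ∈ Finset.range (Fintype.card n), i ≤
      ∑ a, Sum.elim (fun l : Fin M => (l : ℕ)) (fun _ => m) (σ a) := by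
  refine sum_range_le_sum_of_card_le _ fun k hk => ?_
  rw [← Finset.card_range (k + 1)]
  refine Finset.card_le_card_of_injOn
    (fun a => Sum.elim (fun l : Fin M => (l : ℕ)) (fun _ => m) (σ a)) ?_ ?_
  · intro a ha
    simp at ha ⊢
    omega
  · intro a ha b hb hab
    simp only [Finset.coe_filter, Finset.mem_univ, true_and, Set.mem_ofPred_eq] at ha hb hab
    apply hσ
    rcases h1 : σ a with l | l <;> rcases h2 : σ b with l' | l' <;>
      simp only [h1, h2, Sum.elim_inl, Sum.elim_inr] at ha hb hab
    · rw [Fin.ext hab]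
    all_goals omega

/-- The function `z ↦ z ^ i * B ^ z` expanded in binomial coefficients, where `q ∣ B - 1`. -/
lemma exists_choose_expansion (q B : ℤ) (hB : q ∣ B - 1) (i : ℕ) :
    ∃ c : ℕ → ℤ, (∀ l, q ^ l ∣ q ^ i * c l) ∧
      ∀ z M : ℕ, z < M → (z : ℤ) ^ i * B ^ z = ∑ l ∈ Finset.range M, c l * (z.choose l : ℤ) := by
  induction i with
  | zero =>
    refine ⟨fun l => (B - 1) ^ l, fun l => by simpa using pow_dvd_pow_of_dvd hB l, ?_⟩
    intro z M hz
    have h := add_pow (B - 1) 1 z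
    simp only [sub_add_cancel, one_pow, mul_one] at h
    rw [pow_zero, one_mul, h]
    refine Finset.sum_subset (fun l hl => by simp at hl ⊢; omega) fun l _ hl => ?_
    rw [Nat.choose_eq_zero_of_lt (by simpa using hl)]
    simp
  | succ i ih =>
    obtain ⟨c, hc, hz⟩ := ih
    refine ⟨fun l => l * c l + l * (if l = 0 then 0 else c (l - 1)), fun l => ?_, ?_⟩
    · rcases l with _ | l
      · simp
      · simp only [Nat.add_eq_zero_iff, one_ne_zero, and_false, if_false, Nat.add_sub_cancel]
        have h1 : q ^ (l + 1) ∣ q ^ (i + 1) * c l := by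
          rw [pow_succ, pow_succ, mul_right_comm]
          exact mul_dvd_mul_right (hc l) q
        have h2 : q ^ (l + 1) ∣ q ^ (i + 1) * c (l + 1) := by
          rw [pow_succ q i, mul_right_comm]
          exact Dvd.dvd.mul_right (hc (l + 1)) q
        have h3 := dvd_add (h2.mul_left ((l + 1 : ℕ) : ℤ)) (h1.mul_left ((l + 1 : ℕ) : ℤ))
        refine h3.trans (dvd_of_eq ?_)
        push_cast
        ring
    · intro z M hM
      have hpas : ∀ l : ℕ, (z : ℤ) * (z.choose l : ℤ) =
          l * (z.choose l : ℤ) + (l + 1) * (z.choose (l + 1) : ℤ) := by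
        intro l
        have h := Nat.choose_succ_right_eq z l
        rcases le_or_gt l z with hl | hl
        · zify [hl] at h
          linarith
        · rw [Nat.choose_eq_zero_of_lt hl, Nat.choose_eq_zero_of_lt (by omega)]
          simp
      have h1 : (z : ℤ) ^ (i + 1) * B ^ z = ∑ l ∈ Finset.range M, c l * (l * (z.choose l : ℤ)) +
          ∑ l ∈ Finset.range M, c l * ((l + 1) * (z.choose (l + 1) : ℤ)) := by
        rw [pow_succ', mul_assoc, hz z M hM, Finset.mul_sum, ← Finset.sum_add_distrib]
        refine Finset.sum_congr rfl fun l _ => ?_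
        rw [mul_left_comm, hpas l, mul_add]
      obtain ⟨M, rfl⟩ : ∃ M', M = M' + 1 := ⟨M - 1, by omega⟩
      rw [h1]
      rw [Finset.sum_range_succ (fun l => c l * ((l + 1) * (z.choose (l + 1) : ℤ))),
        Nat.choose_eq_zero_of_lt hM]
      simp only [add_mul, Finset.sum_add_distrib]
      congr 1
      · exact Finset.sum_congr rfl fun l _ => by ring
      · rw [Finset.sum_range_succ']
        simp only [Nat.add_eq_zero_iff, one_ne_zero, and_false, if_false, Nat.add_sub_cancel]
        push_cast
        simp only [mul_zero, zero_mul, add_zero]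
        exact Finset.sum_congr rfl fun l _ => by ring

/-- An interpolation determinant whose entries are congruent to multiples of
`z ^ i * (A ^ j) ^ z` is divisible by a large power of the modulus. -/
lemma pow_dvd_interpolation_det {n : Type*} [Fintype n] [DecidableEq n] (q A : ℤ) (m : ℕ)
    (hA : q ∣ A - 1) (hm : Fintype.card n ≤ m) (i j : n → ℕ) (z : n → ℕ) (ρ : n → ℤ)
    (F : Matrix n n ℤ)
    (hF : ∀ a μ, q ^ m ∣ F a μ - ρ a * ((z a : ℤ) ^ i μ * (A ^ j μ) ^ z a)) :
    q ^ (∑ k ∈ Finset.range (Fintype.card n), k) ∣ q ^ (∑ μ, i μ) * F.det := by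
  have hB : ∀ μ, q ∣ A ^ j μ - 1 := fun μ =>
    hA.trans (by simpa using sub_dvd_pow_sub_pow A 1 (j μ))
  choose c hc hcz using fun μ => exists_choose_expansion q (A ^ j μ) (hB μ) (i μ)
  choose d hd using hc
  choose g hg using hF
  obtain ⟨M, hM⟩ : ∃ M, ∀ a, z a < M :=
    ⟨(∑ a, z a) + 1, fun a => Nat.lt_succ_of_le (Finset.single_le_sum (f := z)
      (fun _ _ => Nat.zero_le _) (Finset.mem_univ a))⟩
  have key := pow_dvd_det_of_weighted_sum (n := n) (κ := Fin M ⊕ n) q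
    (Sum.elim (fun l : Fin M => (l : ℕ)) (fun _ => m))
    (fun a => Sum.elim (fun l : Fin M => ρ a * ((z a).choose l : ℤ)) (fun b => if a = b then 1 else 0))
    (Sum.elim (fun l μ => d μ l) (fun b μ => q ^ i μ * g b μ)) _
    (fun σ hσ => sum_range_le_sum_weight M m hm σ hσ)
  rw [← Finset.prod_pow_eq_pow_sum Finset.univ i q, ← Matrix.det_mul_row]
  convert key using 3
  ext a μ
  rw [Fintype.sum_sum_type]
  simp only [Sum.elim_inl, Sum.elim_inr, mul_ite, mul_one, mul_zero, Finset.sum_ite_eq,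
    Finset.mem_univ, if_true]
  have h1 := hg a μ
  rw [hcz μ (z a) M (hM a)] at h1
  have h2 : F a μ = q ^ m * g a μ + ρ a * ∑ l ∈ Finset.range M, c μ l * ((z a).choose l : ℤ) := by
    linarith
  rw [h2, mul_add, add_comm, Finset.mul_sum, Finset.mul_sum, ← Fin.sum_univ_eq_sum_range
    (fun l => q ^ i μ * (ρ a * (c μ l * ((z a).choose l : ℤ))))]
  congr 1
  · refine Finset.sum_congr rfl fun l _ => ?_
    rw [← hd μ l]
    ring
  · ring

open Polynomial in
lemma coeff_prod_sum_of_natDegree_le {ι R : Type*} [CommSemiring R] (s : Finset ι) (f : ι → R[X])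
    (d : ι → ℕ) (h : ∀ i ∈ s, (f i).natDegree ≤ d i) :
    (∏ i ∈ s, f i).coeff (∑ i ∈ s, d i) = ∏ i ∈ s, (f i).coeff (d i) := by
  classical
  induction s using Finset.induction_on with
  | empty => simp
  | insert a s ha ih =>
    rw [Finset.prod_insert ha, Finset.sum_insert ha, Finset.prod_insert ha]
    rw [coeff_mul_add_eq_of_natDegree_le (h a (Finset.mem_insert_self a s)),
      ih fun i hi => h i (Finset.mem_insert_of_mem hi)]
    refine (natDegree_prod_le _ _).trans (Finset.sum_le_sum fun i hi => ?_)
    exact h i (Finset.mem_insert_of_mem hi)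

open Polynomial in
lemma det_coeff_sum {k : Type*} [Fintype k] [DecidableEq k] {R : Type*} [CommRing R]
    (M : Matrix k k R[X]) (d : k → ℕ) (h : ∀ t a, (M t a).natDegree ≤ d a) :
    M.det.natDegree ≤ ∑ a, d a ∧
      M.det.coeff (∑ a, d a) = (Matrix.of fun t a => (M t a).coeff (d a)).det := by
  constructor
  · rw [Matrix.det_apply]
    refine natDegree_sum_le_of_forall_le _ _ fun σ _ => ?_
    refine (natDegree_smul_le _ _).trans ((natDegree_prod_le _ _).trans ?_)
    exact Finset.sum_le_sum fun a _ => h _ _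
  · rw [Matrix.det_apply, Matrix.det_apply, finsetSum_coeff]
    refine Finset.sum_congr rfl fun σ _ => ?_
    rw [coeff_smul, coeff_prod_sum_of_natDegree_le _ _ d fun a _ => h _ _]
    rfl

open Polynomial in
/-- A zero estimate: a nonzero polynomial `∑ Q_j(z) w ^ j` cannot vanish at too many translates. -/
lemma zero_estimate {ι : Type*} {I J : ℕ} (A : ℚ) (hA : 1 < A) (Q : Fin J → ℚ[X])
    (hQ : ∀ j, (Q j).natDegree ≤ I) (P : Finset ι) (hP : I * J < P.card)
    (z w : ι → ℚ) (hz : Set.InjOn z P) (hw : ∀ p ∈ P, w p ≠ 0)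
    (h : ∀ p ∈ P, ∀ t < J, ∑ j, (Q j).eval (z p + t) * (A ^ t * w p) ^ (j : ℕ) = 0) :
    ∀ j, Q j = 0 := by
  classical
  by_contra! hne
  obtain ⟨j₀, hj₀⟩ := hne
  let S := {j : Fin J // Q j ≠ 0}
  let e : Fin (Fintype.card S) ≃ S := (Fintype.equivFin S).symm
  have hcard : Fintype.card S ≤ J := by
    exact (Fintype.card_subtype_le (fun j : Fin J => Q j ≠ 0)).trans_eq (Fintype.card_fin J)
  let M : Matrix (Fin (Fintype.card S)) (Fin (Fintype.card S)) ℚ[X] :=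
    Matrix.of fun t a => C ((A ^ ((e a).1 : ℕ)) ^ (t : ℕ)) * (Q (e a)).comp (X + C (t : ℚ))
  have hd : ∀ t a, (M t a).natDegree ≤ (Q (e a)).natDegree := fun t a => by
    refine (natDegree_C_mul_le _ _).trans ?_
    refine natDegree_comp_le.trans ?_
    rw [natDegree_X_add_C, mul_one]
  obtain ⟨hdeg, hcoeff⟩ := det_coeff_sum M (fun a => (Q (e a)).natDegree) hd
  have hzero : M.det = 0 := by
    refine eq_zero_of_natDegree_lt_card_of_eval_eq_zero' _ (P.image z) (fun ζ hζ => ?_) ?_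
    · obtain ⟨p, hp, rfl⟩ := Finset.mem_image.mp hζ
      rw [← coe_evalRingHom, RingHom.map_det, ← Matrix.exists_mulVec_eq_zero_iff]
      refine ⟨fun a => w p ^ ((e a).1 : ℕ), ?_, ?_⟩
      · intro h0
        have := congrFun h0 (e.symm ⟨j₀, hj₀⟩)
        exact pow_ne_zero _ (hw p hp) this
      · ext t
        have h1 := h p hp t (t.2.trans_le hcard)
        have h2 : ∑ j : Fin J, (Q j).eval (z p + t) * (A ^ (t : ℕ) * w p) ^ (j : ℕ) =
            ∑ j : S, (Q j).eval (z p + t) * (A ^ (t : ℕ) * w p) ^ (j.1 : ℕ) := by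
          rw [← Finset.sum_subtype (Finset.univ.filter fun j => Q j ≠ 0) (by simp)
            (fun j => (Q j).eval (z p + t) * (A ^ (t : ℕ) * w p) ^ (j : ℕ))]
          refine (Finset.sum_filter_of_ne (p := fun j => Q j ≠ 0) fun j _ hj h0 => hj ?_).symm
          rw [h0, eval_zero, zero_mul]
        rw [h2, ← e.sum_comp] at h1
        simp only [Matrix.mulVec, dotProduct, RingHom.mapMatrix_apply, Matrix.map_apply, M,
          Matrix.of_apply, coe_evalRingHom, eval_mul, eval_C, eval_comp, eval_add, eval_X,
          Pi.zero_apply]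
        rw [← h1]
        refine Finset.sum_congr rfl fun a _ => ?_
        rw [mul_pow, ← pow_mul, ← pow_mul, mul_comm (t : ℕ)]
        ring
    · rw [Finset.card_image_of_injOn hz]
      refine (hdeg.trans ?_).trans_lt hP
      calc _ ≤ ∑ _a : Fin (Fintype.card S), I := Finset.sum_le_sum fun a _ => hQ _
        _ ≤ _ := by simp; rw [mul_comm]; exact Nat.mul_le_mul_left _ hcard
  rw [hzero, coeff_zero] at hcoeff
  have h3 : (Matrix.of fun t a => (M t a).coeff (Q (e a)).natDegree) =
      Matrix.of fun t a => (Q (e a)).leadingCoeff *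
        (Matrix.vandermonde fun a => A ^ ((e a).1 : ℕ)).transpose t a := by
    ext t a
    have h4 : ((Q (e a)).comp (X + C (t : ℚ))).coeff (Q (e a)).natDegree
        = (Q (e a)).leadingCoeff := by
      have := coeff_comp_degree_mul_degree (p := Q (e a)) (q := X + C (t : ℚ))
        (by rw [natDegree_X_add_C]; exact one_ne_zero)
      rw [natDegree_X_add_C, mul_one, leadingCoeff_X_add_C, one_pow, mul_one] at this
      exact this
    simp only [Matrix.of_apply, M, coeff_C_mul, h4, Matrix.transpose_apply,
      Matrix.vandermonde_apply]
    ring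
  rw [h3, Matrix.det_mul_row, Matrix.det_transpose, eq_comm, mul_eq_zero] at hcoeff
  rcases hcoeff with h5 | h5
  · obtain ⟨a, -, ha⟩ := Finset.prod_eq_zero_iff.mp h5
    exact (e a).2 (leadingCoeff_eq_zero.mp ha)
  · refine Matrix.det_vandermonde_ne_zero_iff.mpr (fun a b hab => ?_) h5
    have := pow_right_injective₀ (by linarith : 0 < A) hA.ne' hab
    exact e.injective (Subtype.ext (Fin.ext this))

lemma exists_det_ne_zero_of_mulVec_injective {n α K : Type*} [Field K] [Fintype n] [DecidableEq n]
    [Fintype α] (W : Matrix α n K) (hW : ∀ c : n → K, W.mulVec c = 0 → c = 0) :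
    ∃ a : n → α, (W.submatrix a id).det ≠ 0 := by
  obtain ⟨κ, a, ha, hspan, hli⟩ := exists_linearIndependent' K W.row
  have : Finite κ := Finite.of_injective a ha
  have := Fintype.ofFinite κ
  have hrank : W.rank = Fintype.card n := by
    have h1 : Function.Injective W.mulVecLin := by
      rw [← LinearMap.ker_eq_bot, LinearMap.ker_eq_bot']
      exact hW
    rw [Matrix.rank, LinearMap.finrank_range_of_inj h1, Module.finrank_fintype_fun_eq_card]
  have hκ : Fintype.card κ = Fintype.card n := by
    rw [← hrank, Matrix.rank_eq_finrank_span_row, ← hspan, finrank_span_eq_card hli]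
  let f := Fintype.equivOfCardEq hκ.symm
  refine ⟨a ∘ f, ?_⟩
  have h2 : LinearIndependent K (W.submatrix (a ∘ f) id).row :=
    hli.comp f f.injective
  rw [Matrix.linearIndependent_rows_iff_isUnit, Matrix.isUnit_iff_isUnit_det] at h2
  exact h2.ne_zero

/-- The interpolation matrix attached to `y` and `u / v` has a nonsingular square submatrix. -/
lemma exists_interpolation_points (y n e I J T S : ℕ) (u v : ℤ) (hy : 2 ≤ y) (he : 1 ≤ e)
    (hu : u ≠ 0) (hv : v ≠ 0) (hI : 1 ≤ I) (hT : e * T ≤ n) (hST : I * J ≤ S * T) (hJ : 1 ≤ J) :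
    ∃ r s z : Fin I × Fin J → ℕ,
      (∀ a, r a ≤ e * (T + J) ∧ s a ≤ S ∧ e * z a = r a + s a * n) ∧
      (Matrix.of fun a (μ : Fin I × Fin J) =>
        (z a : ℚ) ^ (μ.1 : ℕ) * ((y : ℚ) ^ r a * (u / v : ℚ) ^ s a) ^ (μ.2 : ℕ)).det ≠ 0 := by
  let ρ : ℕ → ℕ := fun s => (s * n * (e - 1)) % e
  have hρ : ∀ s, ρ s < e := fun s => Nat.mod_lt _ he
  have hρn : ∀ s, e ∣ ρ s + s * n := fun s => by
    have h1 : (ρ s + s * n) % e = (s * n * (e - 1) + s * n) % e := Nat.mod_add_mod _ _ _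
    have h2 : s * n * (e - 1) + s * n = s * n * e := by
      rw [← Nat.mul_succ]; congr 1; omega
    rw [h2, Nat.mul_mod_left] at h1
    exact Nat.dvd_of_mod_eq_zero h1
  let rr : Fin S × Fin T × Fin J → ℕ := fun a => ρ a.1 + e * a.2.1 + e * a.2.2
  let ss : Fin S × Fin T × Fin J → ℕ := fun a => a.1
  let ζ : Fin S × Fin T → ℕ := fun a => (ρ a.1 + a.1 * n) / e + a.2
  have hζ : ∀ a, e * ζ a = ρ a.1 + e * a.2 + a.1 * n := fun a => by
    simp only [ζ, mul_add, Nat.mul_div_cancel' (hρn _)]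
    ring
  let zz : Fin S × Fin T × Fin J → ℕ := fun a => ζ (a.1, a.2.1) + a.2.2
  have hζinj : Function.Injective ζ := by
    intro a b hab
    have h1 := hζ a
    rw [hab, hζ b] at h1
    have hlt : ∀ c : Fin S × Fin T, ρ c.1 + e * c.2 < n := fun c => by
      have h2 : e * (c.2 + 1) ≤ e * T := Nat.mul_le_mul_left e c.2.2
      have := hρ c.1
      rw [mul_add] at h2
      omega
    have hs : (a.1 : ℕ) = b.1 := by
      have h3 := congrArg (· / n) h1
      rw [Nat.add_mul_div_right _ _ (by have := hlt a; omega),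
        Nat.add_mul_div_right _ _ (by have := hlt a; omega), Nat.div_eq_of_lt (hlt a),
        Nat.div_eq_of_lt (hlt b)] at h3
      omega
    rw [hs] at h1
    have ht : e * (b.2 : ℕ) = e * a.2 := by omega
    have ht' := Nat.eq_of_mul_eq_mul_left he ht
    exact Prod.ext (Fin.ext hs) (Fin.ext ht'.symm)
  let W : Matrix (Fin S × Fin T × Fin J) (Fin I × Fin J) ℚ := Matrix.of fun a μ =>
    (zz a : ℚ) ^ (μ.1 : ℕ) * ((y : ℚ) ^ rr a * (u / v : ℚ) ^ ss a) ^ (μ.2 : ℕ)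
  have huv : (u / v : ℚ) ≠ 0 := div_ne_zero (by exact_mod_cast hu) (by exact_mod_cast hv)
  have hyQ : (1 : ℚ) < y := by exact_mod_cast hy
  obtain ⟨a, ha⟩ := exists_det_ne_zero_of_mulVec_injective W (fun c hc => by
    let Q : Fin J → Polynomial ℚ := fun j =>
      ∑ i : Fin I, Polynomial.monomial (i : ℕ) (c (i, j))
    have hQ : ∀ j, Q j = 0 := by
      refine zero_estimate (I := I - 1) ((y : ℚ) ^ e) (one_lt_pow₀ hyQ (by omega)) Q ?_
        (Finset.univ : Finset (Fin S × Fin T)) ?_ (fun a => (ζ a : ℚ))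
        (fun a => (y : ℚ) ^ (ρ a.1 + e * a.2) * (u / v : ℚ) ^ (a.1 : ℕ)) ?_ ?_ ?_
      · intro j
        refine Polynomial.natDegree_sum_le_of_forall_le _ _ fun i _ => ?_
        refine (Polynomial.natDegree_monomial_le _).trans ?_
        omega
      · rw [Finset.card_univ, Fintype.card_prod, Fintype.card_fin, Fintype.card_fin]
        refine lt_of_lt_of_le ?_ hST
        exact Nat.mul_lt_mul_of_pos_right (by omega) hJ
      · intro a _ b _ hab
        exact hζinj (Nat.cast_injective hab)
      · intro a _
        exact mul_ne_zero (pow_ne_zero _ (by linarith)) (pow_ne_zero _ huv)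
      · intro a _ t ht
        have h1 := congrFun hc (a.1, a.2, ⟨t, ht⟩)
        simp only [Matrix.mulVec, dotProduct, W, Matrix.of_apply, Pi.zero_apply,
          Fintype.sum_prod_type_right] at h1
        rw [← h1]
        refine Finset.sum_congr rfl fun j _ => ?_
        simp only [Q, Polynomial.eval_finsetSum, Polynomial.eval_monomial, Finset.sum_mul]
        refine Finset.sum_congr rfl fun i _ => ?_
        simp only [zz, rr, ss]
        push_cast
        rw [pow_add _ (ρ _ + _), pow_mul _ e t]
        ring
    ext ⟨i, j⟩
    have h1 := congrArg (fun p => Polynomial.coeff p i) (hQ j)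
    simpa [Q, Polynomial.finsetSum_coeff, Polynomial.coeff_monomial, Fin.val_inj] using h1)
  refine ⟨rr ∘ a, ss ∘ a, zz ∘ a, fun μ => ⟨?_, ?_, ?_⟩, ha⟩
  · have h1 := hρ (a μ).1
    have h2 : e * ((a μ).2.1 + 1) ≤ e * T := Nat.mul_le_mul_left e (a μ).2.1.2
    have h3 : e * ((a μ).2.2 : ℕ) ≤ e * J := Nat.mul_le_mul_left e (a μ).2.2.2.le
    simp only [Function.comp, rr, mul_add] at *
    omega
  · exact (a μ).1.2.le
  · have h1 := hζ ((a μ).1, (a μ).2.1)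
    simp only [Function.comp, zz, rr, ss, mul_add] at *
    omega

lemma abs_interpolation_entry_le (y b R S I J i j r s z : ℕ) (u v : ℤ) (hy : 1 ≤ y)
    (hu : |u| ≤ y) (hv : |v| ≤ y) (hyb : y ≤ 2 ^ b) (hz : z ≤ 2 ^ b) (hr : r ≤ R) (hs : s ≤ S)
    (hi : i ≤ I) (hj : j < J) :
    |(z : ℤ) ^ i * (y ^ (r * j) * u ^ (s * j) * v ^ (s * (J - 1 - j)))| ≤
      2 ^ (b * I + b * ((R + S) * J)) := by
  have hy' : (1 : ℤ) ≤ y := by exact_mod_cast hy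
  have hyb' : (y : ℤ) ≤ 2 ^ b := by exact_mod_cast hyb
  have hz' : (z : ℤ) ≤ 2 ^ b := by exact_mod_cast hz
  simp only [abs_mul, abs_pow, Nat.abs_cast]
  rw [pow_add (2 : ℤ), pow_mul (2 : ℤ), pow_mul (2 : ℤ)]
  have h1 : (z : ℤ) ^ i ≤ (2 ^ b) ^ I :=
    (pow_le_pow_left₀ (by positivity) hz' i).trans (pow_le_pow_right₀ (one_le_pow₀ (by norm_num)) hi)
  have h2 : (y : ℤ) ^ (r * j) * |u| ^ (s * j) * |v| ^ (s * (J - 1 - j)) ≤ (2 ^ b) ^ ((R + S) * J) := by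
    calc _ ≤ (y : ℤ) ^ (r * j) * (y : ℤ) ^ (s * j) * (y : ℤ) ^ (s * (J - 1 - j)) := by gcongr
      _ = (y : ℤ) ^ (r * j + s * (J - 1)) := by
        rw [← pow_add, ← pow_add]
        congr 1
        rw [add_assoc, ← mul_add]
        congr 2
        omega
      _ ≤ (y : ℤ) ^ ((R + S) * J) := by
        refine pow_le_pow_right₀ hy' ?_
        rw [add_mul]
        exact Nat.add_le_add (Nat.mul_le_mul hr hj.le) (Nat.mul_le_mul hs (by omega))
      _ ≤ _ := pow_le_pow_left₀ (by positivity) hyb' _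
  exact mul_le_mul h1 h2 (by positivity) (by positivity)

/-- An effective upper bound for the `q`-adic closeness of `v * y ^ n` and `u`. -/
theorem not_pow_dvd_mul_pow_sub (q y n e m b : ℕ) (u v : ℤ) (hq : 2 ≤ q) (hy : 2 ≤ y)
    (he : 1 ≤ e) (hqe : (q : ℤ) ∣ (y : ℤ) ^ e - 1) (hu0 : u ≠ 0) (hv0 : v ≠ 0)
    (hu : |u| ≤ y) (hv : |v| ≤ y) (hb : 1 ≤ b) (hyb : y ≤ 2 ^ b)
    (hD : e * (10 * b + 3) ^ 4 ≤ 2 ^ b) (hZ : e * (10 * b + 3) ^ 2 * (n + 2) ≤ 2 ^ b)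
    (hn : e * (10 * b + 3) ^ 2 ≤ n) (hm : e * (10 * b + 3) ^ 4 ≤ m) :
    ¬ (q : ℤ) ^ m ∣ v * (y : ℤ) ^ n - u := by
  intro hdvd
  set J := 10 * b + 3 with hJ
  set T := J ^ 2 with hT
  set I := e * J ^ 3 with hI
  set S := e * T with hS
  clear_value S I T J
  have hJ1 : 1 ≤ J := by omega
  have hI1 : 1 ≤ I := by rw [hI]; exact Nat.mul_pos he (pow_pos hJ1 _)
  have hIJ : I * J = e * J ^ 4 := by rw [hI]; ring
  obtain ⟨r, s, z, hrsz, hdet⟩ := exists_interpolation_points y n e I J T S u v hy he hu0 hv0 hI1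
    (by rw [← hS]; exact hn) (le_of_eq (by rw [hIJ, hS, hT]; ring)) hJ1
  have hJT : J ≤ T := by rw [hT]; nlinarith
  have hr : ∀ a, r a ≤ 2 * S := fun a => by
    have h1 := (hrsz a).1
    have h2 : e * (T + J) ≤ e * (T + T) := Nat.mul_le_mul_left _ (by omega)
    rw [hS]; linarith
  have hz : ∀ a, z a ≤ 2 ^ b := fun a => by
    obtain ⟨-, h2, h3⟩ := hrsz a
    have h4 : z a ≤ e * z a := Nat.le_mul_of_pos_left _ he
    have h5 : s a * n ≤ S * n := Nat.mul_le_mul_right _ h2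
    have h6 : S * (n + 2) ≤ 2 ^ b := hZ
    have := hr a
    linarith
  let F : Matrix (Fin I × Fin J) (Fin I × Fin J) ℤ := Matrix.of fun a μ =>
    (z a : ℤ) ^ (μ.1 : ℕ) * ((y : ℤ) ^ (r a * μ.2) * u ^ (s a * μ.2) * v ^ (s a * (J - 1 - μ.2)))
  have hF : F.det ≠ 0 := by
    have h1 : (F.map (Int.cast : ℤ → ℚ)) = Matrix.of fun a μ => (v : ℚ) ^ (s a * (J - 1)) *
        (Matrix.of fun a (μ : Fin I × Fin J) => (z a : ℚ) ^ (μ.1 : ℕ) *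
          ((y : ℚ) ^ r a * (u / v : ℚ) ^ s a) ^ (μ.2 : ℕ)) a μ := by
      ext a μ
      have hv' : (v : ℚ) ≠ 0 := by exact_mod_cast hv0
      have h2 : s a * (J - 1) = s a * (J - 1 - μ.2) + s a * μ.2 := by
        rw [← mul_add]; congr 1; omega
      simp only [F, Matrix.map_apply, Matrix.of_apply]
      rw [h2, pow_add]
      push_cast
      rw [mul_pow, ← pow_mul, ← pow_mul, div_pow]
      field_simp
    intro h0
    have h2 : (F.map (Int.cast : ℤ → ℚ)).det = 0 := by
      have := (Int.castRingHom ℚ).map_det F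
      rw [h0, map_zero] at this
      exact this.symm
    rw [h1, Matrix.det_mul_column] at h2
    rcases mul_eq_zero.mp h2 with h3 | h3
    · obtain ⟨a, -, ha⟩ := Finset.prod_eq_zero_iff.mp h3
      exact pow_ne_zero _ (by exact_mod_cast hv0) ha
    · exact hdet h3
  have hcard : Fintype.card (Fin I × Fin J) = I * J := by simp
  have hdvdF := pow_dvd_interpolation_det (q : ℤ) ((y : ℤ) ^ e) m hqe
    (by rw [hcard, hIJ]; exact hm) (fun μ : Fin I × Fin J => (μ.1 : ℕ)) (fun μ => (μ.2 : ℕ)) z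
    (fun a => v ^ (s a * (J - 1))) F (fun a μ => by
      have h1 : ((y : ℤ) ^ e) ^ (μ.2 : ℕ) = (y : ℤ) ^ (e * μ.2) := by rw [pow_mul]
      have h2 : (((y : ℤ) ^ e) ^ (μ.2 : ℕ)) ^ z a = (y : ℤ) ^ (r a * μ.2) *
          ((y : ℤ) ^ n) ^ (s a * μ.2) := by
        rw [← pow_mul, ← pow_mul, ← pow_mul, ← pow_add]
        congr 1
        rw [mul_left_comm, (hrsz a).2.2]
        ring
      have h3 : s a * (J - 1) = s a * (J - 1 - μ.2) + s a * μ.2 := by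
        rw [← mul_add]; congr 1; omega
      have h4 : F a μ - v ^ (s a * (J - 1)) * ((z a : ℤ) ^ (μ.1 : ℕ) *
          (((y : ℤ) ^ e) ^ (μ.2 : ℕ)) ^ z a) = -((z a : ℤ) ^ (μ.1 : ℕ) * (y : ℤ) ^ (r a * μ.2) *
            v ^ (s a * (J - 1 - μ.2))) *
            ((v * (y : ℤ) ^ n) ^ (s a * μ.2) - u ^ (s a * μ.2)) := by
        rw [h2, h3, pow_add, mul_pow]
        simp only [F, Matrix.of_apply]
        ring
      rw [h4]
      exact (hdvd.trans (sub_dvd_pow_sub_pow _ _ _)).mul_left _)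
  rw [hcard] at hdvdF
  have hle : |F.det| ≤ ((I * J).factorial : ℤ) * (2 ^ (b * I + b * ((2 * S + S) * J))) ^ (I * J) := by
    have := Matrix.det_le (A := F) (abv := AbsoluteValue.abs)
      (x := 2 ^ (b * I + b * ((2 * S + S) * J))) (fun a μ =>
        abs_interpolation_entry_le y b (2 * S) S I J μ.1 μ.2 (r a) (s a) (z a) u v (by omega) hu hv
          hyb (hz a) (hr a) (hrsz a).2.1 μ.1.2.le μ.2.2)
    rw [hcard, nsmul_eq_mul] at this
    exact this
  have hfac : ((I * J).factorial : ℤ) ≤ (2 ^ b) ^ (I * J) := by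
    have h1 := Nat.factorial_le_pow (I * J)
    have h2 : (I * J) ^ (I * J) ≤ (2 ^ b) ^ (I * J) := Nat.pow_le_pow_left (by rw [hIJ]; exact hD) _
    exact_mod_cast h1.trans h2
  have hexp : ∑ k ∈ Finset.range (I * J), k =
      ∑ μ : Fin I × Fin J, (μ.1 : ℕ) + I * J * (I * (5 * b + 1)) := by
    have h1 : ∑ μ : Fin I × Fin J, (μ.1 : ℕ) = J * ∑ k ∈ Finset.range I, k := by
      rw [Fintype.sum_prod_type]
      simp only [Finset.sum_const, Finset.card_univ, Fintype.card_fin, smul_eq_mul]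
      rw [← Finset.mul_sum, Fin.sum_univ_eq_sum_range (fun k => k)]
    have h2 := Finset.sum_range_id_mul_two (I * J)
    have h3 := Finset.sum_range_id_mul_two I
    rw [h1]
    have h4 : 1 ≤ I * J := Nat.mul_pos hI1 hJ1
    zify [h4, hI1] at h2 h3 ⊢
    have h5 : (J : ℤ) = 10 * b + 3 := by rw [hJ]; push_cast; ring
    have h6 : (∑ k ∈ Finset.range (I * J), (k : ℤ)) * 2 =
      (J * ∑ k ∈ Finset.range I, (k : ℤ) + I * J * (I * (5 * b + 1))) * 2 := by
      have h7 : (J * ∑ k ∈ Finset.range I, (k : ℤ)) * 2 = J * (I * (I - 1)) := by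
        rw [mul_assoc, h3]
      rw [h2, add_mul, h7, h5]
      ring
    linarith
  rw [hexp, pow_add] at hdvdF
  have hq0 : (q : ℤ) ^ (∑ μ : Fin I × Fin J, (μ.1 : ℕ)) ≠ 0 := pow_ne_zero _ (by omega)
  have hdvd2 := Int.le_of_dvd (abs_pos.mpr hF)
    ((dvd_abs _ _).mpr ((mul_dvd_mul_iff_left hq0).mp hdvdF))
  have h2q : (2 : ℤ) ^ (I * J * (I * (5 * b + 1))) ≤ (q : ℤ) ^ (I * J * (I * (5 * b + 1))) :=
    pow_le_pow_left₀ (by norm_num) (by exact_mod_cast hq) _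
  have hfin : (2 : ℤ) ^ (I * J * (I * (5 * b + 1))) ≤
      2 ^ ((b + (b * I + b * ((2 * S + S) * J))) * (I * J)) := by
    refine h2q.trans (hdvd2.trans (hle.trans ?_))
    rw [pow_mul 2 (b + _), pow_add 2 b, mul_pow]
    gcongr
  have h7 := (Nat.pow_le_pow_iff_right (a := 2) (by norm_num)).mp (by exact_mod_cast hfin)
  rw [mul_comm (I * J)] at h7
  have h8 := Nat.le_of_mul_le_mul_right h7 (Nat.mul_pos hI1 hJ1)
  have h9 : (2 * S + S) * J = 3 * I := by rw [hS, hT, hI]; ring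
  rw [h9] at h8
  nlinarith

namespace IsNSol

variable {N x y m n : ℕ}

lemma pow_eq (h : IsNSol N x m) : x ^ m = (x - 1) * N + 1 := by
  obtain ⟨hx, -, h⟩ := h
  have h1 := mul_geom_sum (x : ℤ) m
  have h2 : ∑ i ∈ Finset.range m, (x : ℤ) ^ i = N := by exact_mod_cast h
  zify [(by omega : 1 ≤ x)]
  rw [h2] at h1
  linarith

lemma lt_pow (h : IsNSol N x m) : N < x ^ m := by
  have h1 : 1 * N ≤ (x - 1) * N := Nat.mul_le_mul_right _ (by have := h.1; omega)
  rw [h.pow_eq]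
  omega

lemma pow_pred_le (h : IsNSol N x m) : x ^ (m - 1) ≤ N := by
  rw [← h.2.2]
  exact Finset.single_le_sum (f := fun i => x ^ i) (fun _ _ => Nat.zero_le _)
    (by have := h.2.1; simp; omega)

lemma exponent_le_of_lt (hx : IsNSol N x m) (hy : IsNSol N y n) (hxy : x < y) : n ≤ m := by
  have h1 : y ^ (n - 1) < y ^ m :=
    hy.pow_pred_le.trans_lt (hx.lt_pow.trans_le (Nat.pow_le_pow_left hxy.le _))
  have := (Nat.pow_lt_pow_iff_right (by have := hx.1; omega)).mp h1
  omega

lemma base_unique (hx : IsNSol N x m) (hy : IsNSol N y m) : x = y := by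
  have key : ∀ {x y}, IsNSol N x m → IsNSol N y m → ¬ x < y := fun {x y} hx hy hxy => by
    have h1 : ∑ i ∈ Finset.range m, x ^ i < ∑ i ∈ Finset.range m, y ^ i := by
      refine Finset.sum_lt_sum (fun i _ => Nat.pow_le_pow_left hxy.le i) ⟨1, ?_, by simpa using hxy⟩
      have := hx.2.1
      simp; omega
    rw [hx.2.2, hy.2.2] at h1
    exact lt_irrefl _ h1
  rcases lt_trichotomy x y with h | h | h
  · exact absurd h (key hx hy)
  · exact h
  · exact absurd h (key hy hx)

lemma exponent_lt (h : IsNSol N x m) {L : ℕ} (hN : N < 2 ^ (L + 1)) : m < L + 2 := by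
  have h1 : 2 ^ (m - 1) < 2 ^ (L + 1) :=
    (Nat.pow_le_pow_left h.1 _).trans_lt (h.pow_pred_le.trans_lt hN)
  have := (Nat.pow_lt_pow_iff_right (by norm_num)).mp h1
  omega

lemma lt_mul_exponent (h : IsNSol N x m) {L k : ℕ} (hN : 2 ^ L ≤ N) (hx : x ≤ 2 ^ k) :
    L < k * m := by
  have h1 : 2 ^ L < 2 ^ (k * m) := by
    rw [pow_mul]
    exact hN.trans_lt (h.lt_pow.trans_le (Nat.pow_le_pow_left hx _))
  exact (Nat.pow_lt_pow_iff_right (by norm_num)).mp h1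

lemma coprime (hx : IsNSol N x m) (hy : IsNSol N y n) (hxy : x < y) (hyn : y < 2 ^ n) :
    y.Coprime x := by
  by_contra hcop
  obtain ⟨p, hp, hpy, hpx⟩ := Nat.Prime.not_coprime_iff_dvd.mp hcop
  have hx1 := hx.1
  have h1 : (x : ℤ) ^ m = (x - 1) * N + 1 := by
    have := hx.pow_eq
    zify [(by omega : 1 ≤ x)] at this
    exact this
  have h2 : (y : ℤ) ^ n = (y - 1) * N + 1 := by
    have := hy.pow_eq
    zify [(by omega : 1 ≤ y)] at this
    exact this
  have h3 : (p : ℤ) ^ n ∣ (y : ℤ) - x := by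
    have h4 : (p : ℤ) ^ n ∣ (x : ℤ) ^ m :=
      (pow_dvd_pow _ (hx.exponent_le_of_lt hy hxy)).trans
        (pow_dvd_pow_of_dvd (by exact_mod_cast hpx) m)
    have h5 : (p : ℤ) ^ n ∣ (y : ℤ) ^ n := pow_dvd_pow_of_dvd (by exact_mod_cast hpy) n
    have h6 := dvd_sub (h4.mul_right ((y : ℤ) - 1)) (h5.mul_right ((x : ℤ) - 1))
    rw [h1, h2] at h6
    have h7 : ((x - 1) * N + 1) * ((y : ℤ) - 1) - ((y - 1) * N + 1) * (x - 1) = y - x := by ring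
    rwa [h7] at h6
  have h7 := Int.le_of_dvd (by omega) h3
  have h8 : (2 : ℤ) ^ n ≤ (p : ℤ) ^ n := pow_le_pow_left₀ (by norm_num) (by exact_mod_cast hp.two_le) n
  have h9 : (y : ℤ) < 2 ^ n := by exact_mod_cast hyn
  omega

/-- Two solutions cannot both be small compared with their exponents. -/
lemma not_both_small (hx : IsNSol N x m) (hy : IsNSol N y n) (hxy : x < y) {b : ℕ} (hb : 1 ≤ b)
    (hyn : y < 2 ^ n) (hyb : y ≤ 2 ^ b) (hD : x * (10 * b + 3) ^ 4 ≤ 2 ^ b)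
    (hZ : x * (10 * b + 3) ^ 2 * (n + 2) ≤ 2 ^ b) (hn : x * (10 * b + 3) ^ 2 ≤ n)
    (hm : x * (10 * b + 3) ^ 4 ≤ m) : False := by
  have hx1 := hx.1
  have he : x.totient ≤ x := Nat.totient_le x
  have hcop := hx.coprime hy hxy hyn
  have h1 : (x : ℤ) ^ m = (x - 1) * N + 1 := by
    have := hx.pow_eq
    zify [(by omega : 1 ≤ x)] at this
    exact this
  have h2 : (y : ℤ) ^ n = (y - 1) * N + 1 := by
    have := hy.pow_eq
    zify [(by omega : 1 ≤ y)] at this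
    exact this
  refine not_pow_dvd_mul_pow_sub x y n x.totient m b (x - y) (x - 1) hx1 (by omega)
    (Nat.totient_pos.mpr (by omega)) ?_ (by omega) (by omega) (by rw [abs_le]; omega)
    (by rw [abs_le]; omega) hb hyb ((Nat.mul_le_mul_right _ he).trans hD)
    ((Nat.mul_le_mul_right _ (Nat.mul_le_mul_right _ he)).trans hZ)
    ((Nat.mul_le_mul_right _ he).trans hn) ((Nat.mul_le_mul_right _ he).trans hm) ?_
  · have h3 := (Nat.ModEq.pow_totient hcop).symm
    rw [Nat.modEq_iff_dvd] at h3
    exact_mod_cast h3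
  · refine Dvd.intro_left ((y : ℤ) - 1) ?_
    rw [h1, h2]
    ring

lemma log_eq (h : IsNSol N x m) (hN : 0 < N) :
    (Real.log N + Real.log (x - (1 - 1 / (N : ℝ)))) / Real.log x = m := by
  have hx := h.1
  have hx' : (2 : ℝ) ≤ x := by exact_mod_cast hx
  have hN' : (0 : ℝ) < N := by exact_mod_cast hN
  have h1 : (x : ℝ) ^ m = (x - 1) * N + 1 := by
    have := h.pow_eq
    have h2 : ((x ^ m : ℕ) : ℝ) = (((x - 1) * N + 1 : ℕ) : ℝ) := by rw [this]
    push_cast [Nat.cast_sub (by omega : 1 ≤ x)] at h2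
    exact h2
  have hpos : (0 : ℝ) < x - (1 - 1 / (N : ℝ)) := by
    have : (0 : ℝ) < 1 / N := by positivity
    linarith
  rw [← Real.log_mul hN'.ne' hpos.ne']
  have h3 : (N : ℝ) * (x - (1 - 1 / (N : ℝ))) = x ^ m := by
    rw [h1]
    field_simp
    ring
  rw [h3, Real.log_pow, mul_div_assoc, div_self (Real.log_pos (by linarith)).ne', mul_one]

end IsNSol

lemma second_slope_bounds {f f' f'' : ℝ → ℝ} {x y z K : ℝ} (hxy : x < y) (hyz : y < z)
    (hf : ∀ t ∈ Set.Icc x z, HasDerivAt f (f' t) t)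
    (hf' : ∀ t ∈ Set.Icc x z, HasDerivAt f' (f'' t) t)
    (hpos : ∀ t ∈ Set.Icc x z, 0 < f'' t) (hK : ∀ t ∈ Set.Icc x z, f'' t ≤ K) :
    0 < (f z - f y) / (z - y) - (f y - f x) / (y - x) ∧
      (f z - f y) / (z - y) - (f y - f x) / (y - x) ≤ K * (z - x) := by
  obtain ⟨c₁, ⟨h1, h1'⟩, h2⟩ := exists_hasDerivAt_eq_slope f f' hxy
    (fun t ht => (hf t ⟨ht.1, by linarith [ht.2]⟩).continuousAt.continuousWithinAt)
    (fun t ht => hf t ⟨ht.1.le, by linarith [ht.2]⟩)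
  obtain ⟨c₂, ⟨h3, h3'⟩, h4⟩ := exists_hasDerivAt_eq_slope f f' hyz
    (fun t ht => (hf t ⟨by linarith [ht.1], ht.2⟩).continuousAt.continuousWithinAt)
    (fun t ht => hf t ⟨by linarith [ht.1], ht.2.le⟩)
  have hc : c₁ < c₂ := by linarith
  obtain ⟨c, ⟨h5, h5'⟩, h6⟩ := exists_hasDerivAt_eq_slope f' f'' hc
    (fun t ht => (hf' t ⟨by linarith [ht.1], by linarith [ht.2]⟩).continuousAt.continuousWithinAt)
    (fun t ht => hf' t ⟨by linarith [ht.1], by linarith [ht.2]⟩)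
  have hmem : c ∈ Set.Icc x z := ⟨by linarith, by linarith⟩
  rw [← h2, ← h4]
  have h7 : f' c₂ - f' c₁ = f'' c * (c₂ - c₁) := by
    rw [h6, div_mul_cancel₀ _ (by linarith)]
  have h8 := hpos c hmem
  have h9 := hK c hmem
  rw [h7]
  exact ⟨mul_pos h8 (by linarith), mul_le_mul h9 (by linarith) (by linarith) (by linarith)⟩

section LogQuotient

variable {l s t : ℝ}

lemma hasDerivAt_log_quotient (hs : s < 1) (ht : 1 < t) :
    HasDerivAt (fun t => (l + Real.log (t - s)) / Real.log t)
      (1 / ((t - s) * Real.log t) - (l + Real.log (t - s)) / (t * Real.log t ^ 2)) t := by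
  have h0 : 0 < Real.log t := Real.log_pos ht
  have h1 : HasDerivAt (fun t => l + Real.log (t - s)) (1 / (t - s)) t :=
    (((hasDerivAt_id t).sub_const s).log (by simp only [id]; linarith)).const_add l
  have h2 := h1.div (Real.hasDerivAt_log (by linarith : t ≠ 0)) h0.ne'
  refine h2.congr_deriv ?_
  have h3 : t - s ≠ 0 := by linarith
  have h4 : t ≠ 0 := by linarith
  field_simp

lemma hasDerivAt_deriv_log_quotient (hs : s < 1) (ht : 1 < t) :
    HasDerivAt
      (fun t => 1 / ((t - s) * Real.log t) - (l + Real.log (t - s)) / (t * Real.log t ^ 2))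
      ((l + Real.log (t - s)) * (Real.log t + 2) / (t ^ 2 * Real.log t ^ 3) -
        1 / ((t - s) ^ 2 * Real.log t) - 2 / ((t - s) * t * Real.log t ^ 2)) t := by
  have h0 : 0 < Real.log t := Real.log_pos ht
  have h3 : t - s ≠ 0 := by linarith
  have h4 : t ≠ 0 := by linarith
  have h1 : HasDerivAt (fun t => l + Real.log (t - s)) (1 / (t - s)) t :=
    (((hasDerivAt_id t).sub_const s).log (by simp only [id]; linarith)).const_add l
  have hlog := Real.hasDerivAt_log h4
  have h5 := (hasDerivAt_const t (1 : ℝ)).div (((hasDerivAt_id t).sub_const s).mul hlog)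
    (mul_ne_zero h3 h0.ne')
  have h6 := h1.div ((hasDerivAt_id t).mul (hlog.pow 2)) (mul_ne_zero h4 (pow_ne_zero 2 h0.ne'))
  refine (h5.sub h6).congr_deriv ?_
  simp only [id, Pi.mul_apply, Pi.pow_apply]
  field_simp
  ring

lemma second_deriv_log_quotient_bounds (hs0 : 0 ≤ s) (hs : s < 1) (ht : 4 ≤ t)
    (hl : 8 * Real.log t < l) :
    0 < (l + Real.log (t - s)) * (Real.log t + 2) / (t ^ 2 * Real.log t ^ 3) -
        1 / ((t - s) ^ 2 * Real.log t) - 2 / ((t - s) * t * Real.log t ^ 2) ∧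
      (l + Real.log (t - s)) * (Real.log t + 2) / (t ^ 2 * Real.log t ^ 3) -
        1 / ((t - s) ^ 2 * Real.log t) - 2 / ((t - s) * t * Real.log t ^ 2) ≤ 6 * l / t ^ 2 := by
  have h1 : 1 ≤ Real.log t := by
    rw [Real.le_log_iff_exp_le (by linarith)]
    linarith [Real.exp_one_lt_d9]
  have h2 : 0 ≤ Real.log (t - s) := Real.log_nonneg (by linarith)
  have h3 : Real.log (t - s) ≤ Real.log t := Real.log_le_log (by linarith) (by linarith)
  set w := Real.log t
  set v := Real.log (t - s) with hv
  have h4 : t / 2 ≤ t - s := by linarith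
  have h5 : 1 / ((t - s) ^ 2 * w) ≤ 4 / (t ^ 2 * w) := by
    rw [div_le_div_iff₀ (by positivity [show 0 < t - s by linarith]) (by positivity)]
    have : t ^ 2 ≤ 4 * (t - s) ^ 2 := by nlinarith
    nlinarith
  have h6 : 2 / ((t - s) * t * w ^ 2) ≤ 4 / (t ^ 2 * w ^ 2) := by
    rw [div_le_div_iff₀ (by positivity [show 0 < t - s by linarith]) (by positivity)]
    have h7 : t ^ 2 ≤ 2 * ((t - s) * t) := by nlinarith
    have := mul_le_mul_of_nonneg_right h7 (sq_nonneg w)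
    nlinarith
  have hp1 : 0 < 1 / ((t - s) ^ 2 * w) := by positivity [show 0 < t - s by linarith]
  have hp2 : 0 < 2 / ((t - s) * t * w ^ 2) := by positivity [show 0 < t - s by linarith]
  constructor
  · have h7 : l / (t ^ 2 * w ^ 2) ≤ (l + v) * (w + 2) / (t ^ 2 * w ^ 3) := by
      rw [div_le_div_iff₀ (by positivity) (by positivity)]
      have h8 : l * w ≤ (l + v) * (w + 2) := by nlinarith
      have := mul_le_mul_of_nonneg_right h8 (by positivity : 0 ≤ t ^ 2 * w ^ 2)
      nlinarith
    have h9 : 4 / (t ^ 2 * w) + 4 / (t ^ 2 * w ^ 2) < l / (t ^ 2 * w ^ 2) := by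
      have : 4 / (t ^ 2 * w) = 4 * w / (t ^ 2 * w ^ 2) := by field_simp
      rw [this, ← add_div]
      exact div_lt_div_of_pos_right (by linarith) (by positivity)
    linarith
  · have h7 : (l + v) * (w + 2) / (t ^ 2 * w ^ 3) ≤ 6 * l / t ^ 2 := by
      rw [div_le_div_iff₀ (by positivity) (by positivity)]
      have h8 : (l + v) * (w + 2) ≤ (2 * l) * (3 * w) := by
        apply mul_le_mul <;> linarith
      have h10 : w ≤ w ^ 3 := le_self_pow₀ h1 (by norm_num)
      have h11 : (l + v) * (w + 2) ≤ 6 * l * w ^ 3 := by nlinarith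
      have := mul_le_mul_of_nonneg_right h11 (sq_nonneg t)
      nlinarith
    linarith

end LogQuotient

/-- Three solutions cannot lie in a short interval. -/
lemma IsNSol.sq_le_mul_cube {N x y z a b c : ℕ} (hx : IsNSol N x a) (hy : IsNSol N y b)
    (hz : IsNSol N z c) (hxy : x < y) (hyz : y < z) (hx4 : 4 ≤ x)
    (hl : 8 * Real.log z < Real.log N) :
    (x : ℝ) ^ 2 ≤ 6 * Real.log N * ((z : ℝ) - x) ^ 3 := by
  have hN : 0 < N := by
    rcases Nat.eq_zero_or_pos N with h | h
    · subst h
      have := hx.pow_pred_le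
      have : 0 < x ^ (a - 1) := pow_pos (by omega) _
      omega
    · exact h
  have hN1 : (1 : ℝ) ≤ N := by exact_mod_cast hN
  have hxy' : (x : ℝ) + 1 ≤ y := by exact_mod_cast hxy
  have hyz' : (y : ℝ) + 1 ≤ z := by exact_mod_cast hyz
  have hx4' : (4 : ℝ) ≤ x := by exact_mod_cast hx4
  have hs0 : (0 : ℝ) ≤ 1 - 1 / N := by
    rw [sub_nonneg, div_le_one (by linarith)]; exact hN1
  have hs1 : (1 : ℝ) - 1 / N < 1 := by
    have : (0 : ℝ) < 1 / N := by positivity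
    linarith
  have hb : ∀ t ∈ Set.Icc (x : ℝ) z, 8 * Real.log t < Real.log N := fun t ht => by
    have := Real.log_le_log (by linarith [ht.1]) ht.2
    linarith
  have hl0 : 0 < Real.log N := by
    have := hb z ⟨by linarith, le_refl _⟩
    have := Real.log_nonneg (by linarith : (1 : ℝ) ≤ z)
    linarith
  obtain ⟨h1, h2⟩ := second_slope_bounds (K := 6 * Real.log N / x ^ 2)
    (by linarith : (x : ℝ) < y) (by linarith : (y : ℝ) < z)
    (fun t ht => hasDerivAt_log_quotient (l := Real.log N) hs1 (by linarith [ht.1]))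
    (fun t ht => hasDerivAt_deriv_log_quotient (l := Real.log N) hs1 (by linarith [ht.1]))
    (fun t ht => (second_deriv_log_quotient_bounds hs0 hs1 (by linarith [ht.1]) (hb t ht)).1)
    (fun t ht => (second_deriv_log_quotient_bounds hs0 hs1 (by linarith [ht.1]) (hb t ht)).2.trans
      (by have := ht.1; gcongr))
  rw [hx.log_eq hN, hy.log_eq hN, hz.log_eq hN] at h1 h2
  have hu : (0 : ℝ) < y - x := by linarith
  have hv : (0 : ℝ) < z - y := by linarith
  have h3 : ((c : ℝ) - b) / (z - y) - (b - a) / (y - x) =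
      (((c : ℝ) - b) * (y - x) - (b - a) * (z - y)) / ((z - y) * (y - x)) := by
    field_simp
  rw [h3] at h1 h2
  have h4 : (0 : ℝ) < ((c : ℝ) - b) * (y - x) - (b - a) * (z - y) := by
    by_contra h5
    exact absurd h1 (not_lt.mpr (div_nonpos_of_nonpos_of_nonneg (not_lt.mp h5) (by positivity)))
  have h5 : (1 : ℝ) ≤ ((c : ℝ) - b) * (y - x) - (b - a) * (z - y) := by
    have h6 : (0 : ℤ) < ((c : ℤ) - b) * (y - x) - (b - a) * (z - y) := by exact_mod_cast h4
    have h7 : (1 : ℤ) ≤ ((c : ℤ) - b) * (y - x) - (b - a) * (z - y) := h6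
    exact_mod_cast h7
  rw [div_le_iff₀ (by positivity)] at h2
  have h6 : ((z : ℝ) - y) * (y - x) ≤ (z - x) * (z - x) := by
    apply mul_le_mul <;> linarith
  have h7 : 1 ≤ 6 * Real.log N / x ^ 2 * (z - x) * ((z - x) * (z - x)) := by
    refine h5.trans (h2.trans (mul_le_mul_of_nonneg_left h6 ?_))
    have : (0 : ℝ) ≤ z - x := by linarith
    positivity
  have h8 : 6 * Real.log N / x ^ 2 * (z - x) * ((z - x) * (z - x)) =
      6 * Real.log N * ((z : ℝ) - x) ^ 3 / x ^ 2 := by ring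
  rw [h8, le_div_iff₀ (by positivity), one_mul] at h7
  exact h7

lemma exists_forall_log_le :
    ∃ G : ℕ, ∀ g, G ≤ g → 20 * (Nat.log 2 g + 1) * (600 * (Nat.log 2 g + 1) + 3) ^ 4 ≤ g := by
  have h1 := tendsto_pow_const_div_const_pow_of_one_lt 5 (by norm_num : (1 : ℝ) < 2)
  have h2 : (0 : ℝ) < 1 / (40 * 603 ^ 4) := by norm_num
  obtain ⟨K, hK⟩ := Filter.eventually_atTop.mp (h1.eventually_lt_const h2)
  refine ⟨2 ^ (K + 1), fun g hg => ?_⟩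
  have hg0 : g ≠ 0 := by
    have : 0 < 2 ^ (K + 1) := by positivity
    omega
  have h3 : K + 1 ≤ Nat.log 2 g := Nat.le_log_of_pow_le (by norm_num) hg
  have h4 : 2 ^ Nat.log 2 g ≤ g := Nat.pow_log_le_self 2 hg0
  set j := Nat.log 2 g
  have h5 := hK (j + 1) (by omega)
  rw [div_lt_div_iff₀ (by positivity) (by positivity), one_mul] at h5
  have h6 : (j + 1) ^ 5 * (40 * 603 ^ 4) < 2 ^ (j + 1) := by exact_mod_cast h5
  have h7 : (600 * (j + 1) + 3) ^ 4 ≤ (603 * (j + 1)) ^ 4 := Nat.pow_le_pow_left (by omega) 4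
  have h8 : 20 * (j + 1) * (600 * (j + 1) + 3) ^ 4 ≤ 20 * (j + 1) * (603 * (j + 1)) ^ 4 :=
    Nat.mul_le_mul_left _ h7
  have h9 : 2 * (20 * (j + 1) * (603 * (j + 1)) ^ 4) = (j + 1) ^ 5 * (40 * 603 ^ 4) := by ring
  have h10 : 2 ^ (j + 1) = 2 * 2 ^ j := by ring
  omega

lemma IsNSol.not_both_le {N x y m n L g k : ℕ} (hx : IsNSol N x m) (hy : IsNSol N y n)
    (hxy : x < y) (hg : 20 * k * (600 * k + 3) ^ 4 ≤ g) (hgk : g < 2 ^ k) (hN : 2 ^ L ≤ N)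
    (hN' : N < 2 ^ (L + 1)) (hgL : g ^ 10 ≤ L) (hLg : L < (g + 1) ^ 10) (hxg : x ≤ g ^ 9)
    (hyg : y ≤ g ^ 20) : False := by
  have hk : 1 ≤ k := by
    by_contra h
    have h0 : k = 0 := by omega
    subst h0
    have h0 : g = 0 := by simpa using hgk
    subst h0
    have := hx.1
    simp at hxg
    omega
  have hxk : x ≤ 2 ^ (9 * k) := by
    rw [mul_comm, pow_mul]
    exact hxg.trans (Nat.pow_le_pow_left hgk.le 9)
  have hyk : y ≤ 2 ^ (20 * k) := by
    rw [mul_comm, pow_mul]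
    exact hyg.trans (Nat.pow_le_pow_left hgk.le 20)
  have hLm := hx.lt_mul_exponent hN hxk
  have hLn := hy.lt_mul_exponent hN hyk
  have hn2 : n + 2 ≤ 2 ^ (10 * k) + 2 := by
    have h1 := hy.exponent_lt hN'
    have h2 : (g + 1) ^ 10 ≤ 2 ^ (10 * k) := by
      rw [mul_comm, pow_mul]
      exact Nat.pow_le_pow_left hgk 10
    omega
  have hJ1 : 1 ≤ 600 * k + 3 := by omega
  have hJ2 : (600 * k + 3) ^ 2 ≤ (600 * k + 3) ^ 4 := Nat.pow_le_pow_right hJ1 (by norm_num)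
  have hJg : (600 * k + 3) ^ 4 ≤ g := by
    refine le_trans ?_ hg
    exact Nat.le_mul_of_pos_left _ (by omega)
  have hxJ : x * (600 * k + 3) ^ 4 ≤ 2 ^ (10 * k) := by
    calc x * (600 * k + 3) ^ 4 ≤ 2 ^ (9 * k) * 2 ^ k := Nat.mul_le_mul hxk (hJg.trans hgk.le)
      _ = 2 ^ (10 * k) := by rw [← pow_add]; congr 1; omega
  have hxJ' : x * (600 * k + 3) ^ 2 ≤ 2 ^ (10 * k) := (Nat.mul_le_mul_left x hJ2).trans hxJ
  have hm : x * (600 * k + 3) ^ 4 ≤ m := by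
    have h1 : (9 * k) * (x * (600 * k + 3) ^ 4) ≤ g ^ 10 :=
      calc (9 * k) * (x * (600 * k + 3) ^ 4) ≤ x * (20 * k * (600 * k + 3) ^ 4) := by
            have : 0 ≤ x * k * (600 * k + 3) ^ 4 := Nat.zero_le _
            nlinarith
        _ ≤ g ^ 9 * g := Nat.mul_le_mul hxg hg
        _ = g ^ 10 := by ring
    have h2 : (9 * k) * (x * (600 * k + 3) ^ 4) < (9 * k) * m := by omega
    exact (Nat.lt_of_mul_lt_mul_left h2).le
  have hn : x * (600 * k + 3) ^ 2 ≤ n := by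
    have h1 : (20 * k) * (x * (600 * k + 3) ^ 2) ≤ g ^ 10 :=
      calc (20 * k) * (x * (600 * k + 3) ^ 2) = x * (20 * k * (600 * k + 3) ^ 2) := by ring
        _ ≤ x * (20 * k * (600 * k + 3) ^ 4) :=
            Nat.mul_le_mul_left _ (Nat.mul_le_mul_left _ hJ2)
        _ ≤ g ^ 9 * g := Nat.mul_le_mul hxg hg
        _ = g ^ 10 := by ring
    have h2 : (20 * k) * (x * (600 * k + 3) ^ 2) < (20 * k) * n := by omega
    exact (Nat.lt_of_mul_lt_mul_left h2).le
  have hkn : 20 * k < n := by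
    have h1 : 1 * (600 * k + 3) ^ 2 ≤ x * (600 * k + 3) ^ 2 :=
      Nat.mul_le_mul_right _ (by have := hx.1; omega)
    nlinarith
  have hb : 10 * (60 * k) + 3 = 600 * k + 3 := by ring
  have h60 : 2 ^ (20 * k) ≤ 2 ^ (60 * k) := Nat.pow_le_pow_right (by norm_num) (by omega)
  have h10 : 2 ^ (10 * k) ≤ 2 ^ (60 * k) := Nat.pow_le_pow_right (by norm_num) (by omega)
  refine hx.not_both_small hy hxy (b := 60 * k) (by omega)
    (hyk.trans_lt (Nat.pow_lt_pow_right (by norm_num) hkn)) (hyk.trans h60) ?_ ?_ ?_ ?_ <;> rw [hb]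
  · exact hxJ.trans h10
  · calc x * (600 * k + 3) ^ 2 * (n + 2) ≤ 2 ^ (10 * k) * 2 ^ (10 * k + 2) := by
          refine Nat.mul_le_mul hxJ' (hn2.trans ?_)
          have : 1 ≤ 2 ^ (10 * k) := Nat.one_le_two_pow
          rw [pow_add]
          omega
      _ = 2 ^ (20 * k + 2) := by rw [← pow_add]; congr 1; omega
      _ ≤ 2 ^ (60 * k) := Nat.pow_le_pow_right (by norm_num) (by omega)
  · exact hn
  · exact hm

lemma IsNSol.add_sq_lt {N x y z a b c L g : ℕ} (hx : IsNSol N x a) (hy : IsNSol N y b)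
    (hz : IsNSol N z c) (hxy : x < y) (hyz : y < z) (hg : 79 ≤ g) (hN : 2 ^ L ≤ N)
    (hN' : N < 2 ^ (L + 1)) (hgL : g ^ 10 ≤ L) (hLg : L < (g + 1) ^ 10) (hxg : g ^ 9 < x)
    (hzg : z ≤ g ^ 20) : x + g ^ 2 < z := by
  have hg' : (79 : ℝ) ≤ g := by exact_mod_cast hg
  have hgL' : (g : ℝ) ^ 10 ≤ L := by exact_mod_cast hgL
  have hxg' : (g : ℝ) ^ 9 < x := by exact_mod_cast hxg
  have hz2 := hz.1
  have hNpos : (0 : ℝ) < N := by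
    have : 0 < 2 ^ L := by positivity
    exact_mod_cast (by omega : 0 < N)
  have hlogz : Real.log z ≤ 20 * g := by
    have h1 : Real.log z ≤ Real.log ((g : ℝ) ^ 20) :=
      Real.log_le_log (by exact_mod_cast (by omega : 0 < z)) (by exact_mod_cast hzg)
    rw [Real.log_pow] at h1
    have h2 := Real.log_le_self (by linarith : (0 : ℝ) ≤ g)
    push_cast at h1
    linarith
  have hlogN : (L : ℝ) / 2 ≤ Real.log N := by
    have h1 : Real.log ((2 : ℝ) ^ L) ≤ Real.log N :=
      Real.log_le_log (by positivity) (by exact_mod_cast hN)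
    rw [Real.log_pow] at h1
    have h2 := Real.log_two_gt_d9
    have h3 : (0 : ℝ) ≤ L := by positivity
    nlinarith
  have hg10 : (320 : ℝ) * g < g ^ 10 := by
    have h1 : (g : ℝ) ^ 2 ≤ g ^ 9 := pow_le_pow_right₀ (by linarith) (by norm_num)
    have h2 : (g : ℝ) ^ 10 = g ^ 9 * g := by ring
    rw [h2]
    have : (320 : ℝ) < g ^ 9 := by nlinarith
    nlinarith
  have hlogN' : Real.log N ≤ 1024 * (g : ℝ) ^ 10 := by
    have h1 : Real.log N ≤ Real.log ((2 : ℝ) ^ (L + 1)) :=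
      Real.log_le_log hNpos (by exact_mod_cast hN'.le)
    rw [Real.log_pow] at h1
    have h2 : Real.log 2 ≤ 1 := by linarith [Real.log_two_lt_d9]
    have h3 : ((L + 1 : ℕ) : ℝ) ≤ ((g : ℝ) + 1) ^ 10 := by exact_mod_cast hLg
    have h4 : ((g : ℝ) + 1) ^ 10 ≤ (2 * g) ^ 10 := by gcongr; linarith
    have h5 : ((2 : ℝ) * g) ^ 10 = 1024 * g ^ 10 := by ring
    have h6 : (0 : ℝ) ≤ ((L + 1 : ℕ) : ℝ) := by positivity
    nlinarith
  have hx4 : 4 ≤ x := by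
    have h1 : g ≤ g ^ 9 := Nat.le_self_pow (by norm_num) g
    omega
  have h := hx.sq_le_mul_cube hy hz hxy hyz hx4 (by linarith)
  by_contra hcon
  have h1 : ((z : ℝ) - x) ≤ g ^ 2 := by
    have : (z : ℝ) ≤ x + g ^ 2 := by exact_mod_cast not_lt.mp hcon
    linarith
  have h0 : (0 : ℝ) ≤ z - x := by
    have : (x : ℝ) ≤ z := by exact_mod_cast (hxy.trans hyz).le
    linarith
  have h2 : ((z : ℝ) - x) ^ 3 ≤ (g ^ 2) ^ 3 := by gcongr
  have h3 : 6 * Real.log N * ((z : ℝ) - x) ^ 3 ≤ 6 * (1024 * (g : ℝ) ^ 10) * (g ^ 2) ^ 3 := by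
    gcongr
  have h4 : ((g : ℝ) ^ 9) ^ 2 < x ^ 2 := by gcongr
  have h5 : ((g : ℝ) ^ 9) ^ 2 = g ^ 2 * g ^ 16 := by ring
  have h6 : 6 * (1024 * (g : ℝ) ^ 10) * (g ^ 2) ^ 3 = 6144 * g ^ 16 := by ring
  have h7 : (6144 : ℝ) * g ^ 16 ≤ g ^ 2 * g ^ 16 := by gcongr; nlinarith
  linarith

lemma sum_one_div_le_of_sparse (S : Finset ℕ) {d M : ℕ} (hd : 0 < d) (hS : ∀ x ∈ S, d ≤ x)
    (hM : ∀ x ∈ S, x ≤ M)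
    (hsp : ∀ x ∈ S, ∀ y ∈ S, ∀ z ∈ S, x < y → y < z → x + d < z) :
    ∑ x ∈ S, (1 : ℝ) / x ≤ 2 / d * (1 + Real.log M) := by
  have hmaps : ∀ x ∈ S, x / d ∈ Finset.Icc 1 M := fun x hx => by
    rw [Finset.mem_Icc]
    exact ⟨Nat.div_pos (hS x hx) hd, (Nat.div_le_self x d).trans (hM x hx)⟩
  have hd' : (0 : ℝ) < d := by exact_mod_cast hd
  rw [← Finset.sum_fiberwise_of_maps_to hmaps]
  have hfib : ∀ k ∈ Finset.Icc 1 M,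
      ∑ x ∈ S with x / d = k, (1 : ℝ) / x ≤ 2 / d * (k : ℝ)⁻¹ := fun k hk => by
    have hk1 : 1 ≤ k := (Finset.mem_Icc.mp hk).1
    have hk' : (0 : ℝ) < k := by exact_mod_cast hk1
    have hcard : (S.filter (fun x => x / d = k)).card ≤ 2 := by
      have key : ∀ x y z, x ∈ S ∧ x / d = k → y ∈ S ∧ y / d = k → z ∈ S ∧ z / d = k →
          x < y → y < z → False := fun x y z hx hy hz hxy hyz => by
        have h1 := hsp x hx.1 y hy.1 z hz.1 hxy hyz
        have h2 : k * d ≤ x := by rw [← hx.2]; exact Nat.div_mul_le_self x d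
        have h3 : z < (k + 1) * d := by
          exact (Nat.div_lt_iff_lt_mul hd).mp (by omega)
        rw [add_mul] at h3
        omega
      by_contra hcon
      obtain ⟨x, y, z, hx, hy, hz, hxy, hxz, hyz⟩ := Finset.two_lt_card_iff.mp (not_le.mp hcon)
      rw [Finset.mem_filter] at hx hy hz
      rcases lt_or_gt_of_ne hxy with h1 | h1 <;> rcases lt_or_gt_of_ne hxz with h2 | h2 <;>
        rcases lt_or_gt_of_ne hyz with h3 | h3
      · exact key x y z hx hy hz h1 h3
      · exact key x z y hx hz hy h2 h3
      · omega
      · exact key z x y hz hx hy h2 h1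
      · exact key y x z hy hx hz h1 h2
      · omega
      · exact key y z x hy hz hx h3 h2
      · exact key z y x hz hy hx h3 h1
    have hterm : ∀ x ∈ S.filter (fun x => x / d = k), (1 : ℝ) / x ≤ 1 / (d * k) := fun x hx => by
      rw [Finset.mem_filter] at hx
      have h2 : d * k ≤ x := by rw [← hx.2]; exact Nat.mul_div_le x d
      have h3 : (d : ℝ) * k ≤ x := by exact_mod_cast h2
      exact one_div_le_one_div_of_le (by positivity) h3
    have h4 := Finset.sum_le_card_nsmul _ _ _ hterm
    refine h4.trans ?_
    rw [nsmul_eq_mul]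
    have h5 : ((S.filter (fun x => x / d = k)).card : ℝ) ≤ 2 := by exact_mod_cast hcard
    calc _ ≤ (2 : ℝ) * (1 / (d * k)) := by gcongr
      _ = 2 / d * (k : ℝ)⁻¹ := by field_simp
  refine (Finset.sum_le_sum hfib).trans ?_
  rw [← Finset.mul_sum]
  have h6 := harmonic_le_one_add_log M
  rw [harmonic_eq_sum_Icc] at h6
  push_cast at h6
  gcongr

lemma sum_one_div_le_of_isNSol {N L T : ℕ} (S : Finset ℕ) (hS : ∀ x ∈ S, ∃ m, IsNSol N x m)
    (hN' : N < 2 ^ (L + 1)) (hT : 0 < T) (hST : ∀ x ∈ S, T ≤ x) :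
    ∑ x ∈ S, (1 : ℝ) / x ≤ (L + 2) / T := by
  choose! f hf using hS
  have hT' : (0 : ℝ) < T := by exact_mod_cast hT
  have hcard : S.card ≤ (Finset.range (L + 2)).card := by
    refine Finset.card_le_card_of_injOn f (fun x hx => ?_) (fun x hx y hy hxy => ?_)
    · simpa using (hf x hx).exponent_lt hN'
    · have h1 := hf y hy
      rw [← hxy] at h1
      exact (hf x hx).base_unique h1
  rw [Finset.card_range] at hcard
  have h1 : ∀ x ∈ S, (1 : ℝ) / x ≤ 1 / T := fun x hx =>
    one_div_le_one_div_of_le hT' (by exact_mod_cast hST x hx)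
  refine (Finset.sum_le_card_nsmul _ _ _ h1).trans ?_
  rw [nsmul_eq_mul, mul_one_div]
  gcongr
  exact_mod_cast hcard

lemma exists_pow_le_lt_succ_pow {d : ℕ} (hd : d ≠ 0) (L : ℕ) :
    ∃ g, g ^ d ≤ L ∧ L < (g + 1) ^ d := by
  have h0 : 0 ^ d ≤ L := by simp [hd]
  refine ⟨Nat.findGreatest (fun g => g ^ d ≤ L) L,
    Nat.findGreatest_spec (P := fun g => g ^ d ≤ L) (Nat.zero_le L) h0, ?_⟩
  by_contra! h
  have h1 := Nat.le_findGreatest (P := fun g => g ^ d ≤ L) ((Nat.le_self_pow hd _).trans h) h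
  omega

open scoped Classical in
theorem stmt1 :
    ∀ ε : ℝ, 0 < ε → ∃ N₀ : ℕ, ∀ N : ℕ, N₀ ≤ N → 2 ≤ N →
      ∀ x₁ m₁ : ℕ, IsNSol N x₁ m₁ → (∀ x m : ℕ, IsNSol N x m → x₁ ≤ x) →
        ∑ x ∈ (Finset.range (N + 1)).filter (fun x => x₁ < x ∧ ∃ m, IsNSol N x m),
          (1 : ℝ) / x < ε := by
  intro ε hε
  obtain ⟨G₀, hG₀⟩ := exists_forall_log_le
  obtain ⟨G₁, hG₁⟩ := exists_nat_gt (1067 / ε)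
  set G := max (max G₀ G₁) 79
  refine ⟨2 ^ (G ^ 10), fun N hNG hN2 x₁ m₁ hx₁ hmin => ?_⟩
  set L := Nat.log 2 N
  have hN : 2 ^ L ≤ N := Nat.pow_log_le_self 2 (by omega)
  have hN' : N < 2 ^ (L + 1) := Nat.lt_pow_succ_log_self (by norm_num) N
  obtain ⟨g, hgL, hLg⟩ := exists_pow_le_lt_succ_pow (by norm_num : 10 ≠ 0) L
  have hGg : G ≤ g := by
    have h1 : G ^ 10 ≤ L := Nat.le_log_of_pow_le (by norm_num) hNG
    have h2 := lt_of_pow_lt_pow_left₀ 10 (Nat.zero_le _) (h1.trans_lt hLg)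
    omega
  have hg79 : 79 ≤ g := (le_max_right _ _).trans hGg
  have hgk := hG₀ g ((le_max_left _ _).trans ((le_max_left _ _).trans hGg))
  have hgk' : g < 2 ^ (Nat.log 2 g + 1) := Nat.lt_pow_succ_log_self (by norm_num) g
  have hgε : 1067 / (g : ℝ) < ε := by
    have h1 : (G₁ : ℝ) ≤ g := by
      exact_mod_cast (le_max_right G₀ G₁).trans ((le_max_left _ _).trans hGg)
    have h2 : (0 : ℝ) < g := by exact_mod_cast (by omega : 0 < g)
    rw [div_lt_iff₀ hε] at hG₁
    rw [div_lt_iff₀ h2]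
    nlinarith
  have hgr : (79 : ℝ) ≤ g := by exact_mod_cast hg79
  set S := (Finset.range (N + 1)).filter (fun x => x₁ < x ∧ ∃ m, IsNSol N x m)
  have hS : ∀ x ∈ S, x₁ < x ∧ ∃ m, IsNSol N x m := fun x hx => (Finset.mem_filter.mp hx).2
  have hbig : ∀ x ∈ S, x ≤ g ^ 20 → g ^ 9 < x₁ := fun x hx hxg => by
    obtain ⟨hlt, m, hm⟩ := hS x hx
    by_contra! h
    exact hx₁.not_both_le hm hlt hgk hgk' hN hN' hgL hLg h hxg
  rw [← Finset.sum_filter_add_sum_filter_not S (fun x => x ≤ g ^ 20)]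
  have hsmall : ∑ x ∈ S with x ≤ g ^ 20, (1 : ℝ) / x ≤ 42 / g := by
    have h1 : ∑ x ∈ S with x ≤ g ^ 20, (1 : ℝ) / x
        ≤ 2 / (g ^ 2 : ℕ) * (1 + Real.log (g ^ 20 : ℕ)) := by
      refine sum_one_div_le_of_sparse _ (by positivity) ?_ ?_ ?_
      · intro x hx
        rw [Finset.mem_filter] at hx
        have h2 := hbig x hx.1 hx.2
        have h3 : g ^ 2 ≤ g ^ 9 := Nat.pow_le_pow_right (by omega) (by norm_num)
        have h4 := (hS x hx.1).1
        omega
      · intro x hx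
        exact (Finset.mem_filter.mp hx).2
      · intro x hx y hy z hz hxy hyz
        rw [Finset.mem_filter] at hx hy hz
        obtain ⟨hlt, a, ha⟩ := hS x hx.1
        obtain ⟨-, b, hb⟩ := hS y hy.1
        obtain ⟨-, c, hc⟩ := hS z hz.1
        exact ha.add_sq_lt hb hc hxy hyz hg79 hN hN' hgL hLg ((hbig x hx.1 hx.2).trans hlt) hz.2
    refine h1.trans ?_
    push_cast
    rw [Real.log_pow]
    have h2 := Real.log_le_self (by linarith : (0 : ℝ) ≤ g)
    have h3 : 1 + ((20 : ℕ) : ℝ) * Real.log g ≤ 21 * g := by push_cast; linarith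
    calc 2 / (g : ℝ) ^ 2 * (1 + ((20 : ℕ) : ℝ) * Real.log g) ≤ 2 / (g : ℝ) ^ 2 * (21 * g) := by
          gcongr
      _ = 42 / (g : ℝ) := by field_simp; norm_num
  have hlarge : ∑ x ∈ S with ¬ x ≤ g ^ 20, (1 : ℝ) / x ≤ 1025 / g := by
    have h1 := sum_one_div_le_of_isNSol (S.filter (fun x => ¬ x ≤ g ^ 20)) (N := N) (L := L)
      (T := g ^ 20) (fun x hx => (hS x (Finset.mem_filter.mp hx).1).2) hN' (by positivity)
      (fun x hx => (not_le.mp (Finset.mem_filter.mp hx).2).le)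
    refine h1.trans ?_
    have h2 : (L : ℝ) + 1 ≤ ((g : ℝ) + 1) ^ 10 := by exact_mod_cast hLg
    have h3 : ((g : ℝ) + 1) ^ 10 ≤ (2 * g) ^ 10 := by gcongr; linarith
    have h4 : ((2 : ℝ) * g) ^ 10 = 1024 * g ^ 10 := by ring
    have h5 : (1 : ℝ) ≤ (g : ℝ) ^ 10 := one_le_pow₀ (by linarith)
    have h6 : (g : ℝ) ^ 11 ≤ (g : ℝ) ^ 20 := pow_le_pow_right₀ (by linarith) (by norm_num)
    push_cast
    rw [div_le_div_iff₀ (by positivity) (by positivity)]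
    calc ((L : ℝ) + 2) * g ≤ (1025 * g ^ 10) * g := by gcongr; linarith
      _ = 1025 * g ^ 11 := by ring
      _ ≤ 1025 * g ^ 20 := by gcongr
  have h1 : (42 : ℝ) / g + 1025 / g = 1067 / g := by rw [← add_div]; norm_num
  linarith
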